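/- arXiv:math/0406434 — 2 statements merged into one kernel-verified Lean document; each statement's English description precedes it below -/
import Mathlib

section
/- Let p be an odd rational prime. The set of elements g ∈ H₍₁,₂,₂₎ with N(g) = p is finite, and its cardinality equals 24(p + 1). -/
open Quaternion

noncomputable section

/-- `v₁ = 1` -/
def v₁ : ℍ[ℝ] := 1

/-- `v₂ = i` -/
def v₂ : ℍ[ℝ] := ⟨0, 1, 0, 0⟩

/-- `v₃ = (1 + i + √2·j)/2` -/
def v₃ : ℍ[ℝ] := ⟨1/2, 1/2, Real.sqrt 2 / 2, 0⟩

/-- `v₄ = (1 + i + √2·k)/2` -/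
def v₄ : ℍ[ℝ] := ⟨1/2, 1/2, 0, Real.sqrt 2 / 2⟩

/-- The quaternion order `H₍₁,₂,₂₎`: the ℤ-span of `{v₁, v₂, v₃, v₄}`. -/
def H122 : Set ℍ[ℝ] :=
  {q | ∃ a b c d : ℤ, q = a • v₁ + b • v₂ + c • v₃ + d • v₄}

/-- The order `H₍₁,₂,₂₎` in integer coordinates with respect to `v₁, v₂, v₃, v₄`. -/
@[ext]
structure Order122 where
  a : ℤ
  b : ℤ
  c : ℤ
  d : ℤ

namespace Order122

instance : DecidableEq Order122 := fun x y =>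
  decidable_of_iff (x.a = y.a ∧ x.b = y.b ∧ x.c = y.c ∧ x.d = y.d) Order122.ext_iff.symm

instance : Zero Order122 := ⟨⟨0, 0, 0, 0⟩⟩
instance : One Order122 := ⟨⟨1, 0, 0, 0⟩⟩
instance : Add Order122 := ⟨fun x y => ⟨x.a + y.a, x.b + y.b, x.c + y.c, x.d + y.d⟩⟩
instance : Neg Order122 := ⟨fun x => ⟨-x.a, -x.b, -x.c, -x.d⟩⟩
instance : Mul Order122 := ⟨fun x y =>
  ⟨x.a * y.a - x.b * y.b - x.b * y.c - x.d * y.b - x.c * y.c - x.d * y.d - x.d * y.c,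
   x.a * y.b + x.b * y.a + x.b * y.d + x.c * y.b + x.c * y.d - x.d * y.c,
   x.a * y.c + x.c * y.a - x.b * y.d + x.d * y.b + x.c * y.c + x.d * y.c,
   x.a * y.d + x.d * y.a + x.b * y.c - x.c * y.b + x.d * y.d + x.d * y.c⟩⟩

@[simp] lemma zero_a : (0 : Order122).a = 0 := rfl
@[simp] lemma zero_b : (0 : Order122).b = 0 := rfl
@[simp] lemma zero_c : (0 : Order122).c = 0 := rfl
@[simp] lemma zero_d : (0 : Order122).d = 0 := rfl
@[simp] lemma one_a : (1 : Order122).a = 1 := rfl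
@[simp] lemma one_b : (1 : Order122).b = 0 := rfl
@[simp] lemma one_c : (1 : Order122).c = 0 := rfl
@[simp] lemma one_d : (1 : Order122).d = 0 := rfl
@[simp] lemma add_a (x y : Order122) : (x + y).a = x.a + y.a := rfl
@[simp] lemma add_b (x y : Order122) : (x + y).b = x.b + y.b := rfl
@[simp] lemma add_c (x y : Order122) : (x + y).c = x.c + y.c := rfl
@[simp] lemma add_d (x y : Order122) : (x + y).d = x.d + y.d := rfl
@[simp] lemma neg_a (x : Order122) : (-x).a = -x.a := rfl
@[simp] lemma neg_b (x : Order122) : (-x).b = -x.b := rfl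
@[simp] lemma neg_c (x : Order122) : (-x).c = -x.c := rfl
@[simp] lemma neg_d (x : Order122) : (-x).d = -x.d := rfl
@[simp] lemma mul_a (x y : Order122) : (x * y).a =
    x.a * y.a - x.b * y.b - x.b * y.c - x.d * y.b - x.c * y.c - x.d * y.d - x.d * y.c := rfl
@[simp] lemma mul_b (x y : Order122) : (x * y).b =
    x.a * y.b + x.b * y.a + x.b * y.d + x.c * y.b + x.c * y.d - x.d * y.c := rfl
@[simp] lemma mul_c (x y : Order122) : (x * y).c =
    x.a * y.c + x.c * y.a - x.b * y.d + x.d * y.b + x.c * y.c + x.d * y.c := rfl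
@[simp] lemma mul_d (x y : Order122) : (x * y).d =
    x.a * y.d + x.d * y.a + x.b * y.c - x.c * y.b + x.d * y.d + x.d * y.c := rfl

instance : Ring Order122 where
  add_assoc x y z := by ext <;> simp <;> ring
  zero_add x := by ext <;> simp
  add_zero x := by ext <;> simp
  add_comm x y := by ext <;> simp <;> ring
  left_distrib x y z := by ext <;> simp <;> ring
  right_distrib x y z := by ext <;> simp <;> ring
  zero_mul x := by ext <;> simp
  mul_zero x := by ext <;> simp
  mul_assoc x y z := by ext <;> simp <;> ring
  one_mul x := by ext <;> simp
  mul_one x := by ext <;> simp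
  neg_add_cancel x := by ext <;> simp
  nsmul := nsmulRec
  zsmul := zsmulRec

@[simp] lemma sub_a (x y : Order122) : (x - y).a = x.a - y.a := by simp [sub_eq_add_neg]
@[simp] lemma sub_b (x y : Order122) : (x - y).b = x.b - y.b := by simp [sub_eq_add_neg]
@[simp] lemma sub_c (x y : Order122) : (x - y).c = x.c - y.c := by simp [sub_eq_add_neg]
@[simp] lemma sub_d (x y : Order122) : (x - y).d = x.d - y.d := by simp [sub_eq_add_neg]

/-- An integer as an element of the order. -/
def ofInt (n : ℤ) : Order122 := ⟨n, 0, 0, 0⟩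

/-- Quaternion conjugation. -/
def conj (x : Order122) : Order122 := ⟨x.a + x.c + x.d, -x.b, -x.c, -x.d⟩

/-- The quaternion norm. -/
def norm (x : Order122) : ℤ :=
  x.a ^ 2 + x.b ^ 2 + (x.a + x.b) * (x.c + x.d) + x.c ^ 2 + x.d ^ 2 + x.c * x.d

lemma mul_conj (x : Order122) : x * conj x = ofInt (norm x) := by
  ext <;> simp [conj, ofInt, norm] <;> ring

lemma conj_mul (x : Order122) : conj x * x = ofInt (norm x) := by
  ext <;> simp [conj, ofInt, norm] <;> ring

lemma norm_mul (x y : Order122) : norm (x * y) = norm x * norm y := by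
  simp only [norm, mul_a, mul_b, mul_c, mul_d]; ring

lemma norm_conj (x : Order122) : norm (conj x) = norm x := by
  simp only [norm, conj]; ring

lemma norm_ofInt (n : ℤ) : norm (ofInt n) = n ^ 2 := by
  simp [norm, ofInt]

lemma four_mul_norm (x : Order122) : 4 * norm x =
    (2 * x.a + x.c + x.d) ^ 2 + (2 * x.b + x.c + x.d) ^ 2 + 2 * x.c ^ 2 + 2 * x.d ^ 2 := by
  simp only [norm]; ring

lemma norm_nonneg (x : Order122) : 0 ≤ norm x := by
  have := four_mul_norm x
  nlinarith [sq_nonneg (2 * x.a + x.c + x.d), sq_nonneg (2 * x.b + x.c + x.d),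
    sq_nonneg x.c, sq_nonneg x.d]

lemma norm_eq_zero {x : Order122} : norm x = 0 ↔ x = 0 := by
  constructor
  · intro h
    have h4 := four_mul_norm x
    have h1 := sq_nonneg (2 * x.a + x.c + x.d)
    have h2 := sq_nonneg (2 * x.b + x.c + x.d)
    have hc : x.c = 0 := pow_eq_zero_iff two_ne_zero |>.1
      (by nlinarith [sq_nonneg x.c, sq_nonneg x.d])
    have hd : x.d = 0 := pow_eq_zero_iff two_ne_zero |>.1
      (by nlinarith [sq_nonneg x.c, sq_nonneg x.d])
    rw [h, hc, hd] at h4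
    have ha : x.a = 0 := pow_eq_zero_iff two_ne_zero |>.1
      (by nlinarith [sq_nonneg x.a, sq_nonneg x.b])
    have hb : x.b = 0 := pow_eq_zero_iff two_ne_zero |>.1
      (by nlinarith [sq_nonneg x.a, sq_nonneg x.b])
    ext <;> simp [*]
  · rintro rfl
    simp [norm]

lemma norm_pos {x : Order122} (hx : x ≠ 0) : 0 < norm x :=
  (norm_nonneg x).lt_of_ne fun h => hx (norm_eq_zero.1 h.symm)

instance : NoZeroDivisors Order122 where
  eq_zero_or_eq_zero_of_mul_eq_zero {x y} h := by
    have := norm_mul x y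
    rw [h, norm_eq_zero.2 rfl] at this
    rcases mul_eq_zero.1 this.symm with h | h
    · exact Or.inl (norm_eq_zero.1 h)
    · exact Or.inr (norm_eq_zero.1 h)

lemma exists_abs_two_mul_sub_le (m : ℤ) {n : ℤ} (hn : 0 < n) (s : ℤ) :
    ∃ q : ℤ, |2 * m + s - 2 * n * q| ≤ n := by
  refine ⟨(2 * m + s + n) / (2 * n), ?_⟩
  have h1 := Int.emod_add_mul_ediv (2 * m + s + n) (2 * n)
  have h2 := Int.emod_nonneg (2 * m + s + n) (b := 2 * n) (by omega)
  have h3 := Int.emod_lt_of_pos (2 * m + s + n) (b := 2 * n) (by omega)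
  rw [abs_le]
  constructor <;> linarith

lemma exists_norm_sub_mul_lt (z : Order122) {n : ℤ} (hn : 0 < n) :
    ∃ q : Order122, norm (z - q * ofInt n) < n ^ 2 := by
  obtain ⟨c, hc⟩ := exists_abs_two_mul_sub_le z.c hn 0
  obtain ⟨d, hd⟩ := exists_abs_two_mul_sub_le z.d hn 0
  obtain ⟨a, ha⟩ := exists_abs_two_mul_sub_le z.a hn (z.c + z.d - n * (c + d))
  obtain ⟨b, hb⟩ := exists_abs_two_mul_sub_le z.b hn (z.c + z.d - n * (c + d))
  refine ⟨⟨a, b, c, d⟩, ?_⟩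
  have h4 := four_mul_norm (z - ⟨a, b, c, d⟩ * ofInt n)
  simp only [ofInt, sub_a, sub_b, sub_c, sub_d, mul_a, mul_b, mul_c, mul_d] at h4 ⊢
  have := sq_le_sq' (abs_le.1 hc).1 (abs_le.1 hc).2
  have := sq_le_sq' (abs_le.1 hd).1 (abs_le.1 hd).2
  have := sq_le_sq' (abs_le.1 ha).1 (abs_le.1 ha).2
  have := sq_le_sq' (abs_le.1 hb).1 (abs_le.1 hb).2
  have := pow_pos hn 2
  linarith

lemma exists_norm_sub_mul_lt_norm (x : Order122) {g : Order122} (hg : g ≠ 0) :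
    ∃ q : Order122, norm (x - q * g) < norm g := by
  have hpos := norm_pos hg
  obtain ⟨q, hq⟩ := exists_norm_sub_mul_lt (x * conj g) hpos
  refine ⟨q, ?_⟩
  rw [← mul_conj, ← mul_assoc, ← sub_mul, norm_mul, norm_conj, sq] at hq
  exact lt_of_mul_lt_mul_right hq hpos.le

lemma exists_generator (I : Submodule Order122 Order122) (hI : I ≠ ⊥) :
    ∃ g ∈ I, g ≠ 0 ∧ ∀ x ∈ I, ∃ q, x = q * g := by
  obtain ⟨y, hy, hy0⟩ := I.ne_bot_iff.1 hI
  obtain ⟨g, ⟨hg, hg0⟩, hmin⟩ := (measure fun x : Order122 => (norm x).toNat).wf.has_min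
    {x | x ∈ I ∧ x ≠ 0} ⟨y, hy, hy0⟩
  refine ⟨g, hg, hg0, fun x hx => ?_⟩
  obtain ⟨q, hq⟩ := exists_norm_sub_mul_lt_norm x hg0
  refine ⟨q, sub_eq_zero.1 <| by_contra fun h => ?_⟩
  refine hmin (x - q * g) ⟨I.sub_mem hx (I.smul_mem q hg), h⟩ ?_
  have := norm_nonneg (x - q * g)
  change (norm (x - q * g)).toNat < (norm g).toNat
  omega

lemma card_norm_eq_one : Nat.card {u : Order122 // norm u = 1} = 24 := by
  let s : Finset Order122 :=
    ((Finset.Icc (-2 : ℤ) 2 ×ˢ Finset.Icc (-2 : ℤ) 2) ×ˢ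
      (Finset.Icc (-1 : ℤ) 1 ×ˢ Finset.Icc (-1 : ℤ) 1)).image
      (fun t => ⟨t.1.1, t.1.2, t.2.1, t.2.2⟩) |>.filter (fun u => norm u = 1)
  have hs : ∀ u, u ∈ s ↔ norm u = 1 := by
    intro u
    simp only [s, Finset.mem_filter, Finset.mem_image, Finset.mem_product, Finset.mem_Icc,
      and_iff_right_iff_imp]
    intro h
    have h4 := four_mul_norm u
    rw [h] at h4
    have h1 := sq_nonneg (2 * u.a + u.c + u.d)
    have h2 := sq_nonneg (2 * u.b + u.c + u.d)
    have h3 := sq_nonneg u.c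
    have h5 := sq_nonneg u.d
    have hc := abs_lt_of_sq_lt_sq' (a := u.c) (b := 2) (by linarith) (by norm_num)
    have hd := abs_lt_of_sq_lt_sq' (a := u.d) (b := 2) (by linarith) (by norm_num)
    have ha := abs_le_of_sq_le_sq' (a := 2 * u.a + u.c + u.d) (b := 2) (by linarith) (by norm_num)
    have hb := abs_le_of_sq_le_sq' (a := 2 * u.b + u.c + u.d) (b := 2) (by linarith) (by norm_num)
    exact ⟨((u.a, u.b), (u.c, u.d)), by simp only; omega, rfl⟩
  rw [Nat.subtype_card s hs]
  decide +kernel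

section Splitting

variable {K : Type*} [Field K]

/-- The real part of `x`, read in `K`. -/
def re (K : Type*) [Field K] (x : Order122) : K := x.a + (x.c + x.d) / 2

/-- The coordinate along `i` of `x`, read in `K`. -/
def imI (K : Type*) [Field K] (x : Order122) : K := x.b + (x.c + x.d) / 2

/-- The coordinate along `(j - k) / √2` of `x`, read in `K`. -/
def imJ (K : Type*) [Field K] (x : Order122) : K := (x.c - x.d) / 2

/-- The coordinate along `(j + k) / √2` of `x`, read in `K`. -/
def imK (K : Type*) [Field K] (x : Order122) : K := (x.c + x.d) / 2

lemma re_mul (h2 : (2 : K) ≠ 0) (x y : Order122) : re K (x * y) =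
    re K x * re K y - imI K x * imI K y - imJ K x * imJ K y - imK K x * imK K y := by
  simp only [re, imI, imJ, imK, mul_a, mul_c, mul_d]
  push_cast
  field_simp
  ring

lemma imI_mul (h2 : (2 : K) ≠ 0) (x y : Order122) : imI K (x * y) =
    re K x * imI K y + imI K x * re K y + imJ K x * imK K y - imK K x * imJ K y := by
  simp only [re, imI, imJ, imK, mul_b, mul_c, mul_d]
  push_cast
  field_simp
  ring

lemma imJ_mul (h2 : (2 : K) ≠ 0) (x y : Order122) : imJ K (x * y) =
    re K x * imJ K y + imJ K x * re K y + imK K x * imI K y - imI K x * imK K y := by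
  simp only [re, imI, imJ, imK, mul_c, mul_d]
  push_cast
  field_simp
  ring

lemma imK_mul (h2 : (2 : K) ≠ 0) (x y : Order122) : imK K (x * y) =
    re K x * imK K y + imK K x * re K y + imI K x * imJ K y - imJ K x * imI K y := by
  simp only [re, imI, imJ, imK, mul_c, mul_d]
  push_cast
  field_simp
  ring

lemma norm_cast_eq (h2 : (2 : K) ≠ 0) (x : Order122) :
    (norm x : K) = re K x ^ 2 + imI K x ^ 2 + imJ K x ^ 2 + imK K x ^ 2 := by
  simp only [re, imI, imJ, imK, norm]
  push_cast
  field_simp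
  ring

/-- The action of `x` on `K × K` when `i` acts as `!![α, β; β, -α]`, with `α ^ 2 + β ^ 2 = -1`,
and `(j - k) / √2` acts as `!![0, 1; -1, 0]`. -/
def act (α β : K) (x : Order122) (w : K × K) : K × K :=
  ((re K x + (imI K x * α - imK K x * β)) * w.1 + (imI K x * β + imK K x * α + imJ K x) * w.2,
   (imI K x * β + imK K x * α - imJ K x) * w.1 + (re K x - (imI K x * α - imK K x * β)) * w.2)

lemma act_mul (h2 : (2 : K) ≠ 0) {α β : K} (h : α ^ 2 + β ^ 2 = -1) (x y : Order122) (w : K × K) :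
    act α β (x * y) w = act α β x (act α β y w) := by
  simp only [act, re_mul h2, imI_mul h2, imJ_mul h2, imK_mul h2]
  ext
  · linear_combination -((imI K x * imI K y + imK K x * imK K y) * w.1
      + (imI K x * imK K y - imK K x * imI K y) * w.2) * h
  · linear_combination -((imI K x * imI K y + imK K x * imK K y) * w.2
      - (imI K x * imK K y - imK K x * imI K y) * w.1) * h

lemma act_add (α β : K) (x y : Order122) (w : K × K) :
    act α β (x + y) w = act α β x w + act α β y w := by
  ext <;> simp [act, re, imI, imJ, imK] <;> ring

lemma act_zero_right (α β : K) (x : Order122) : act α β x 0 = 0 := by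
  simp [act]

lemma act_ofInt (α β : K) (n : ℤ) (w : K × K) : act α β (ofInt n) w = (n : K) • w := by
  ext <;> simp [act, ofInt, re, imI, imJ, imK]

/-- The left ideal of elements annihilating `w`. -/
def annihilator (h2 : (2 : K) ≠ 0) {α β : K} (h : α ^ 2 + β ^ 2 = -1) (w : K × K) :
    Submodule Order122 Order122 where
  carrier := {x | act α β x w = 0}
  zero_mem' := by simp [act, re, imI, imJ, imK]
  add_mem' {x y} hx hy := by
    rw [Set.mem_ofPred_eq] at *
    rw [act_add, hx, hy, add_zero]
  smul_mem' q x hx := by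
    rw [Set.mem_ofPred_eq] at *
    rw [smul_eq_mul, act_mul h2 h, hx, act_zero_right]

/-- Representatives of the lines in `K × K`. -/
def lineRep : Option K → K × K
  | none => (0, 1)
  | some t => (1, t)

lemma lineRep_ne_zero (t : Option K) : lineRep t ≠ 0 := by
  cases t <;> simp [lineRep, Prod.ext_iff]

lemma cast_eq_zero_of_act_eq_zero (h2 : (2 : K) ≠ 0) {α β : K} (h : α ^ 2 + β ^ 2 = -1)
    {x : Order122} (h0 : act α β x (1, 0) = 0) (h1 : act α β x (0, 1) = 0) :
    (x.a : K) = 0 ∧ (x.b : K) = 0 ∧ (x.c : K) = 0 ∧ (x.d : K) = 0 := by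
  simp only [act, Prod.ext_iff, Prod.fst_zero, Prod.snd_zero, mul_one, mul_zero, add_zero,
    zero_add] at h0 h1
  have hA : re K x = 0 := by
    have : 2 * re K x = 0 := by linear_combination h0.1 + h1.2
    simpa [h2] using this
  have hC : imJ K x = 0 := by
    have : 2 * imJ K x = 0 := by linear_combination h1.1 - h0.2
    simpa [h2] using this
  rw [hA, hC] at h0 h1
  have hB : imI K x = 0 := by
    linear_combination -α * h0.1 - β * h0.2 + imI K x * h
  have hD : imK K x = 0 := by
    linear_combination β * h0.1 - α * h0.2 + imK K x * h
  have hc : (x.c : K) = imK K x + imJ K x := by simp only [imK, imJ]; field_simp; ring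
  have hd : (x.d : K) = imK K x - imJ K x := by simp only [imK, imJ]; field_simp; ring
  have ha : (x.a : K) = re K x - imK K x := by simp only [imK, re]; ring
  have hb : (x.b : K) = imI K x - imK K x := by simp only [imK, imI]; ring
  simp [ha, hb, hc, hd, hA, hB, hC, hD]

lemma eq_zero_of_lineRep_ne {m n : K} {t t' : Option K} (ht : t ≠ t')
    (h : m * (lineRep t).1 + n * (lineRep t).2 = 0)
    (h' : m * (lineRep t').1 + n * (lineRep t').2 = 0) : m = 0 ∧ n = 0 := by
  rcases t with _ | t <;> rcases t' with _ | t' <;>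
    simp only [lineRep, mul_one, mul_zero, zero_add] at h h'
  · exact absurd rfl ht
  · simpa [h] using h'
  · simpa [h'] using h
  · have hn : (t - t') * n = 0 := by linear_combination h - h'
    have hn : n = 0 := (mul_eq_zero.1 hn).resolve_left fun e => ht (by rw [sub_eq_zero.1 e])
    simpa [hn] using h

lemma act_eq_zero_of_lineRep_ne {α β : K} {x : Order122} {t t' : Option K} (ht : t ≠ t')
    (h : act α β x (lineRep t) = 0) (h' : act α β x (lineRep t') = 0) (w : K × K) :
    act α β x w = 0 := by
  simp only [act, Prod.ext_iff, Prod.fst_zero, Prod.snd_zero] at h h' ⊢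
  obtain ⟨h1, h2⟩ := eq_zero_of_lineRep_ne ht h.1 h'.1
  obtain ⟨h3, h4⟩ := eq_zero_of_lineRep_ne ht h.2 h'.2
  simp [h1, h2, h3, h4]

lemma exists_act_eq {p : ℕ} [Fact p.Prime] (h2 : (2 : ZMod p) ≠ 0) {α β : ZMod p}
    (h : α ^ 2 + β ^ 2 = -1) (m n r s : ZMod p) :
    ∃ x, ∀ w, act α β x w = (m * w.1 + n * w.2, r * w.1 + s * w.2) := by
  obtain ⟨a, ha⟩ := ZMod.intCast_surjective
    ((m + s) / 2 - (β * ((m - s) / 2) - α * ((n + r) / 2)))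
  obtain ⟨b, hb⟩ := ZMod.intCast_surjective
    (-(α * ((m - s) / 2) + β * ((n + r) / 2)) - (β * ((m - s) / 2) - α * ((n + r) / 2)))
  obtain ⟨c, hc⟩ := ZMod.intCast_surjective
    ((n - r) / 2 + (β * ((m - s) / 2) - α * ((n + r) / 2)))
  obtain ⟨d, hd⟩ := ZMod.intCast_surjective
    ((β * ((m - s) / 2) - α * ((n + r) / 2)) - (n - r) / 2)
  have hK : imK (ZMod p) ⟨a, b, c, d⟩ = β * ((m - s) / 2) - α * ((n + r) / 2) := by
    simp only [imK, hc, hd]; field_simp; ring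
  have hA : re (ZMod p) ⟨a, b, c, d⟩ = (m + s) / 2 := by
    rw [re, ← imK, hK]; simp only [ha]; ring
  have hI : imI (ZMod p) ⟨a, b, c, d⟩ = -(α * ((m - s) / 2) + β * ((n + r) / 2)) := by
    rw [imI, ← imK, hK]; simp only [hb]; ring
  have hJ : imJ (ZMod p) ⟨a, b, c, d⟩ = (n - r) / 2 := by
    simp only [imJ, hc, hd]; field_simp; ring
  have hP : imI (ZMod p) ⟨a, b, c, d⟩ * α - imK (ZMod p) ⟨a, b, c, d⟩ * β = (m - s) / 2 := by
    rw [hI, hK]; linear_combination -(m - s) / 2 * h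
  have hQ : imI (ZMod p) ⟨a, b, c, d⟩ * β + imK (ZMod p) ⟨a, b, c, d⟩ * α = (n + r) / 2 := by
    rw [hI, hK]; linear_combination -(n + r) / 2 * h
  refine ⟨⟨a, b, c, d⟩, fun w => ?_⟩
  rw [act, hP, hQ, hA, hJ]
  ext <;> field_simp <;> ring

lemma exists_mem_annihilator {p : ℕ} [Fact p.Prime] (h2 : (2 : ZMod p) ≠ 0) {α β : ZMod p}
    (h : α ^ 2 + β ^ 2 = -1) (t : Option (ZMod p)) :
    ∃ x ∈ annihilator h2 h (lineRep t), ∃ w, act α β x w ≠ 0 := by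
  rcases t with _ | t
  · obtain ⟨x, hx⟩ := exists_act_eq h2 h 1 0 0 0
    exact ⟨x, by change act α β x _ = 0; simp [hx, lineRep], (1, 0), by simp [hx]⟩
  · obtain ⟨x, hx⟩ := exists_act_eq h2 h t (-1) 0 0
    exact ⟨x, by change act α β x _ = 0; simp [hx, lineRep], (0, 1), by simp [hx]⟩

lemma exists_act_eq_zero (h2 : (2 : K) ≠ 0) {α β : K} (h : α ^ 2 + β ^ 2 = -1)
    {x : Order122} (hx : (norm x : K) = 0) : ∃ t, act α β x (lineRep t) = 0 := by
  rw [norm_cast_eq h2] at hx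
  have hdet : (re K x + (imI K x * α - imK K x * β)) * (re K x - (imI K x * α - imK K x * β)) =
      (imI K x * β + imK K x * α + imJ K x) * (imI K x * β + imK K x * α - imJ K x) := by
    linear_combination hx - (imI K x ^ 2 + imK K x ^ 2) * h
  unfold act
  generalize re K x + (imI K x * α - imK K x * β) = m at *
  generalize re K x - (imI K x * α - imK K x * β) = s at *
  generalize imI K x * β + imK K x * α + imJ K x = n at *
  generalize imI K x * β + imK K x * α - imJ K x = r at *
  by_cases hn : n = 0
  · by_cases hs : s = 0
    · exact ⟨none, by simp [lineRep, hn, hs]⟩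
    · have hm : m = 0 := by simpa [hn, hs] using hdet
      exact ⟨some (-r / s), by ext <;> simp [lineRep, hn, hm]; field_simp; ring⟩
  · refine ⟨some (-m / n), ?_⟩
    ext
    · simp [lineRep]; field_simp; ring
    · simp [lineRep]; field_simp; linear_combination -hdet

lemma norm_cast_eq_zero (h2 : (2 : K) ≠ 0) {α β : K} (h : α ^ 2 + β ^ 2 = -1)
    {x : Order122} {w : K × K} (hw : w ≠ 0) (hx : act α β x w = 0) : (norm x : K) = 0 := by
  have : act α β (ofInt (norm x)) w = 0 := by
    rw [← conj_mul, act_mul h2 h, hx, act_zero_right]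
  rw [act_ofInt] at this
  exact (smul_eq_zero.1 this).resolve_right hw

end Splitting

section Counting

variable {p : ℕ} [hp : Fact p.Prime] {α β : ZMod p}

lemma exists_act_ne_zero_of_norm_eq (h2 : (2 : ZMod p) ≠ 0) (h : α ^ 2 + β ^ 2 = -1)
    {x : Order122} (hx : norm x = p) : ∃ w, act α β x w ≠ 0 := by
  by_contra! H
  obtain ⟨ha, hb, hc, hd⟩ := cast_eq_zero_of_act_eq_zero h2 h (H _) (H _)
  rw [ZMod.intCast_zmod_eq_zero_iff_dvd] at ha hb hc hd
  obtain ⟨a, ha⟩ := ha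
  obtain ⟨b, hb⟩ := hb
  obtain ⟨c, hc⟩ := hc
  obtain ⟨d, hd⟩ := hd
  have hnorm : norm x = p * (p * norm ⟨a, b, c, d⟩) := by
    simp only [norm, ha, hb, hc, hd]
    ring
  have hx' : (p : ℤ) * 1 = p * (p * norm ⟨a, b, c, d⟩) := by rw [mul_one, ← hnorm, hx]
  have hp0 : (p : ℤ) ≠ 0 := by exact_mod_cast hp.out.ne_zero
  have hdvd : (p : ℤ) ∣ 1 := ⟨_, mul_left_cancel₀ hp0 hx'⟩
  exact hp.out.one_lt.ne' (by exact_mod_cast Int.eq_one_of_dvd_one (by positivity) hdvd)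

lemma exists_generator_norm_eq (h2 : (2 : ZMod p) ≠ 0) (h : α ^ 2 + β ^ 2 = -1)
    (t : Option (ZMod p)) : ∃ g, norm g = p ∧ act α β g (lineRep t) = 0 ∧
      ∀ x, act α β x (lineRep t) = 0 → ∃ q, x = q * g := by
  obtain ⟨x, hxI, w, hw⟩ := exists_mem_annihilator h2 h t
  have hI : annihilator h2 h (lineRep t) ≠ ⊥ := by
    refine (Submodule.ne_bot_iff _).2 ⟨x, hxI, ?_⟩
    rintro rfl
    exact hw (by simp [act, re, imI, imJ, imK])
  obtain ⟨g, hg, hg0, hgen⟩ := exists_generator _ hI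
  refine ⟨g, ?_, hg, hgen⟩
  have hp0 : (p : ℤ) ≠ 0 := by exact_mod_cast hp.out.ne_zero
  have hpz : Prime (p : ℤ) := Nat.prime_iff_prime_int.1 hp.out
  obtain ⟨k, hk⟩ := (ZMod.intCast_zmod_eq_zero_iff_dvd _ _).1
    (norm_cast_eq_zero h2 h (lineRep_ne_zero t) hg)
  have hact : ∀ v, act α β (ofInt p) v = 0 := fun v => by rw [act_ofInt]; simp
  obtain ⟨y, hy⟩ := hgen (ofInt p) (hact _)
  have hyk : (p : ℤ) = norm y * k := by
    have := congrArg norm hy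
    rw [norm_ofInt, norm_mul, hk] at this
    exact mul_left_cancel₀ hp0 (by linear_combination this)
  have hgpos := norm_pos hg0
  have hk0 : 0 < k := by
    rw [hk] at hgpos
    exact (mul_pos_iff_of_pos_left (by exact_mod_cast hp.out.pos)).1 hgpos
  rcases hpz.irreducible.isUnit_or_isUnit hyk with hu | hu
  · have hy1 : norm y = 1 := (Int.isUnit_iff.1 hu).resolve_right
      fun e => by linarith [norm_nonneg y]
    have hg' : g = conj y * ofInt p := by
      rw [hy, ← mul_assoc, conj_mul, hy1]
      exact (one_mul g).symm
    obtain ⟨q, rfl⟩ := hgen x hxI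
    refine absurd ?_ hw
    rw [hg', ← mul_assoc, act_mul h2 h, hact, act_zero_right]
  · have hk1 : k = 1 := (Int.isUnit_iff.1 hu).resolve_right fun e => by linarith
    rw [hk, hk1, mul_one]

lemma card_norm_eq_prime (hodd : p ≠ 2) :
    Nat.card {x : Order122 // norm x = p} = 24 * (p + 1) := by
  have h2 : (2 : ZMod p) ≠ 0 := by
    intro e
    have : p ∣ 2 := (ZMod.natCast_eq_zero_iff 2 p).1 (by exact_mod_cast e)
    exact hodd ((Nat.prime_dvd_prime_iff_eq hp.out Nat.prime_two).1 this)
  have hp0 : (p : ℤ) ≠ 0 := by exact_mod_cast hp.out.ne_zero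
  obtain ⟨α, β, h⟩ := ZMod.sq_add_sq p (-1)
  choose g hgn hg hgen using exists_generator_norm_eq (p := p) h2 h
  let f : {u : Order122 // norm u = 1} × Option (ZMod p) → {x : Order122 // norm x = p} :=
    fun ut => ⟨ut.1 * g ut.2, by rw [norm_mul, ut.1.2, hgn, one_mul]⟩
  have hf : Function.Bijective f := by
    constructor
    · rintro ⟨⟨u, hu⟩, t⟩ ⟨⟨u', hu'⟩, t'⟩ e
      have e : u * g t = u' * g t' := congrArg Subtype.val e
      have ht : t = t' := by
        by_contra ht
        obtain ⟨w, hw⟩ := exists_act_ne_zero_of_norm_eq h2 h (f (⟨u, hu⟩, t)).2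
        refine hw (act_eq_zero_of_lineRep_ne ht ?_ ?_ w)
        · change act α β (u * g t) _ = 0
          rw [act_mul h2 h, hg, act_zero_right]
        · change act α β (u * g t) _ = 0
          rw [e, act_mul h2 h, hg, act_zero_right]
      subst ht
      have hg0 : g t ≠ 0 := fun e0 => hp0 (by rw [← hgn t, norm_eq_zero.2 e0])
      have := mul_right_cancel₀ hg0 e
      subst this
      rfl
    · rintro ⟨x, hx⟩
      obtain ⟨t, ht⟩ := exists_act_eq_zero h2 h (x := x) (by rw [hx]; simp)
      obtain ⟨q, rfl⟩ := hgen t x ht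
      rw [norm_mul, hgn] at hx
      exact ⟨(⟨q, mul_right_cancel₀ hp0 (hx.trans (one_mul _).symm)⟩, t), rfl⟩
  rw [← Nat.card_congr (Equiv.ofBijective f hf), Nat.card_prod, card_norm_eq_one,
    Finite.card_option, Nat.card_zmod]

end Counting

/-- The quaternion with the given coordinates. -/
def toQuaternion (x : Order122) : ℍ[ℝ] := x.a • v₁ + x.b • v₂ + x.c • v₃ + x.d • v₄

lemma re_toQuaternion (x : Order122) : (toQuaternion x).re = x.a + (x.c + x.d) / 2 := by
  simp only [toQuaternion, re_add, re_smul]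
  simp [v₁, v₂, v₃, v₄]
  ring

lemma imI_toQuaternion (x : Order122) : (toQuaternion x).imI = x.b + (x.c + x.d) / 2 := by
  simp only [toQuaternion, imI_add, imI_smul]
  simp [v₁, v₂, v₃, v₄]
  ring

lemma imJ_toQuaternion (x : Order122) : (toQuaternion x).imJ = x.c * (√2 / 2) := by
  simp only [toQuaternion, imJ_add, imJ_smul]
  simp [v₁, v₂, v₃, v₄]

lemma imK_toQuaternion (x : Order122) : (toQuaternion x).imK = x.d * (√2 / 2) := by
  simp only [toQuaternion, imK_add, imK_smul]
  simp [v₁, v₂, v₃, v₄]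

lemma toQuaternion_injective : Function.Injective toQuaternion := by
  intro x y e
  have ha := congrArg (fun q : ℍ[ℝ] => q.re) e
  have hb := congrArg (fun q : ℍ[ℝ] => q.imI) e
  have hc := congrArg (fun q : ℍ[ℝ] => q.imJ) e
  have hd := congrArg (fun q : ℍ[ℝ] => q.imK) e
  simp only [re_toQuaternion, imI_toQuaternion, imJ_toQuaternion, imK_toQuaternion]
    at ha hb hc hd
  have hs : √2 / 2 ≠ 0 := by positivity
  have hc := mul_right_cancel₀ hs hc
  have hd := mul_right_cancel₀ hs hd
  rw [hc, hd] at ha hb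
  ext
  · exact_mod_cast add_right_cancel ha
  · exact_mod_cast add_right_cancel hb
  · exact_mod_cast hc
  · exact_mod_cast hd

lemma normSq_toQuaternion (x : Order122) : normSq (toQuaternion x) = norm x := by
  rw [normSq_def', re_toQuaternion, imI_toQuaternion, imJ_toQuaternion, imK_toQuaternion]
  simp only [norm]
  push_cast
  linear_combination ((x.c : ℝ) ^ 2 + (x.d : ℝ) ^ 2) / 4 * Real.sq_sqrt (zero_le_two (α := ℝ))

lemma toQuaternion_mul_star_eq_iff (x : Order122) (n : ℕ) :
    toQuaternion x * star (toQuaternion x) = (n : ℍ[ℝ]) ↔ norm x = n := by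
  rw [self_mul_star, normSq_toQuaternion, ← coe_natCast, coe_inj]
  norm_cast

lemma H122_eq_range : H122 = Set.range toQuaternion := by
  ext q
  constructor
  · rintro ⟨a, b, c, d, rfl⟩
    exact ⟨⟨a, b, c, d⟩, rfl⟩
  · rintro ⟨x, rfl⟩
    exact ⟨x.a, x.b, x.c, x.d, rfl⟩

lemma setOf_norm_eq_image (n : ℕ) : {g : ℍ[ℝ] | g ∈ H122 ∧ g * star g = (n : ℍ[ℝ])} =
    Set.image toQuaternion {x | norm x = n} := by
  ext q
  constructor
  · rintro ⟨hq, h⟩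
    rw [H122_eq_range] at hq
    obtain ⟨x, rfl⟩ := hq
    exact ⟨x, (toQuaternion_mul_star_eq_iff x n).1 h, rfl⟩
  · rintro ⟨x, hx, rfl⟩
    exact ⟨H122_eq_range ▸ ⟨x, rfl⟩, (toQuaternion_mul_star_eq_iff x n).2 hx⟩

end Order122

/-- For an odd rational prime `p`, the set of elements of `H₍₁,₂,₂₎` of norm `p`
is finite of cardinality `24(p + 1)`. -/
theorem prime_norm_count (p : ℕ) (hp : p.Prime) (hodd : p ≠ 2) :
    {g : ℍ[ℝ] | g ∈ H122 ∧ g * star g = (p : ℍ[ℝ])}.Finite ∧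
    {g : ℍ[ℝ] | g ∈ H122 ∧ g * star g = (p : ℍ[ℝ])}.ncard = 24 * (p + 1) := by
  have : Fact p.Prime := ⟨hp⟩
  have hcard : {g : ℍ[ℝ] | g ∈ H122 ∧ g * star g = (p : ℍ[ℝ])}.ncard = 24 * (p + 1) := by
    rw [Order122.setOf_norm_eq_image,
      Set.ncard_image_of_injective _ Order122.toQuaternion_injective]
    exact Order122.card_norm_eq_prime hodd
  exact ⟨Set.finite_of_ncard_pos (by omega), hcard⟩
end
end

section
/- Let c ∈ H₍₁,₂,₂₎ be a primitive quaternion, and let (p₁, p₂, …, p_k) be any list of rational primes (with multiplicity, in any order) whose product equals N(c). Then there exists a unique list (π₁, π₂, …, π_k) of primary elements of H₍₁,₂,₂₎ with N(πᵢ) = pᵢ for each i and c = π₁·π₂·⋯·π_k. -/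
open Quaternion

noncomputable section

/-- `q` is primary: `q ∈ H₍₁,₂,₂₎` and `q − 1` or `q − (1 + 2v₃)` lies in `2(1+i)·H₍₁,₂,₂₎`. -/
def Primary (q : ℍ[ℝ]) : Prop :=
  q ∈ H122 ∧
    ((∃ h ∈ H122, q - 1 = 2 * (1 + v₂) * h) ∨
     (∃ h ∈ H122, q - (1 + 2 * v₃) = 2 * (1 + v₂) * h))

/-- `c` is primitive: `c` is primary and its coordinates with respect to the ℤ-basis
`{v₁, v₂, v₃, v₄}` have gcd `1`. -/
def Primitive (c : ℍ[ℝ]) : Prop :=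
  Primary c ∧
    ∀ c₁ c₂ c₃ c₄ : ℤ, c = c₁ • v₁ + c₂ • v₂ + c₃ • v₃ + c₄ • v₄ →
      Int.gcd (Int.gcd c₁ c₂) (Int.gcd c₃ c₄) = 1

/-- The element of `H122` with given integer coordinates in the basis `v₁, v₂, v₃, v₄`. -/
def ofCoords (a b c d : ℤ) : ℍ[ℝ] := a • v₁ + b • v₂ + c • v₃ + d • v₄

theorem ofCoords_mem (a b c d : ℤ) : ofCoords a b c d ∈ H122 := ⟨a, b, c, d, rfl⟩

theorem re_ofCoords (a b c d : ℤ) : (ofCoords a b c d).re = a + (c + d) / 2 := by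
  have h1 : v₁.re = 1 := rfl
  have h2 : v₂.re = 0 := rfl
  have h3 : v₃.re = 1 / 2 := rfl
  have h4 : v₄.re = 1 / 2 := rfl
  simp [ofCoords, h1, h2, h3, h4]
  ring

theorem imI_ofCoords (a b c d : ℤ) : (ofCoords a b c d).imI = b + (c + d) / 2 := by
  have h1 : v₁.imI = 0 := rfl
  have h2 : v₂.imI = 1 := rfl
  have h3 : v₃.imI = 1 / 2 := rfl
  have h4 : v₄.imI = 1 / 2 := rfl
  simp [ofCoords, h1, h2, h3, h4]
  ring

theorem imJ_ofCoords (a b c d : ℤ) : (ofCoords a b c d).imJ = Real.sqrt 2 / 2 * c := by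
  have h1 : v₁.imJ = 0 := rfl
  have h2 : v₂.imJ = 0 := rfl
  have h3 : v₃.imJ = Real.sqrt 2 / 2 := rfl
  have h4 : v₄.imJ = 0 := rfl
  simp [ofCoords, h1, h2, h3, h4]
  ring

theorem imK_ofCoords (a b c d : ℤ) : (ofCoords a b c d).imK = Real.sqrt 2 / 2 * d := by
  have h1 : v₁.imK = 0 := rfl
  have h2 : v₂.imK = 0 := rfl
  have h3 : v₃.imK = 0 := rfl
  have h4 : v₄.imK = Real.sqrt 2 / 2 := rfl
  simp [ofCoords, h1, h2, h3, h4]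
  ring

theorem ofCoords_inj {a b c d a' b' c' d' : ℤ} (h : ofCoords a b c d = ofCoords a' b' c' d') :
    a = a' ∧ b = b' ∧ c = c' ∧ d = d' := by
  have h1 := congrArg QuaternionAlgebra.re h
  have h2 := congrArg QuaternionAlgebra.imI h
  have h3 := congrArg QuaternionAlgebra.imJ h
  have h4 := congrArg QuaternionAlgebra.imK h
  rw [re_ofCoords, re_ofCoords] at h1
  rw [imI_ofCoords, imI_ofCoords] at h2
  rw [imJ_ofCoords, imJ_ofCoords] at h3
  rw [imK_ofCoords, imK_ofCoords] at h4
  have hs : Real.sqrt 2 / 2 ≠ 0 := by positivity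
  have hc := mul_left_cancel₀ hs h3
  have hd := mul_left_cancel₀ hs h4
  rw [hc, hd] at h1 h2
  exact ⟨by exact_mod_cast add_right_cancel h1, by exact_mod_cast add_right_cancel h2,
    by exact_mod_cast hc, by exact_mod_cast hd⟩

theorem ofCoords_mul (a b c d e f g h : ℤ) : ofCoords a b c d * ofCoords e f g h =
    ofCoords (a * e - b * f - b * g - d * f - c * g - d * h - d * g)
      (a * f + b * e + c * f + b * h + c * h - d * g)
      (a * g + c * e + c * g - b * h + d * f + d * g)
      (a * h + d * e + b * g - c * f + d * h + d * g) := by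
  have hs : Real.sqrt 2 ^ 2 = 2 := Real.sq_sqrt (by norm_num)
  apply Quaternion.ext <;>
    simp only [Quaternion.re_mul, Quaternion.imI_mul, Quaternion.imJ_mul, Quaternion.imK_mul,
      re_ofCoords, imI_ofCoords, imJ_ofCoords, imK_ofCoords] <;>
    push_cast <;> ring_nf <;> (try rw [hs]) <;> ring

theorem ofCoords_add (a b c d e f g h : ℤ) : ofCoords a b c d + ofCoords e f g h =
    ofCoords (a + e) (b + f) (c + g) (d + h) := by
  simp only [ofCoords, add_smul]; abel

theorem ofCoords_neg (a b c d : ℤ) : -ofCoords a b c d = ofCoords (-a) (-b) (-c) (-d) := by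
  simp only [ofCoords, neg_smul]; abel

theorem ofCoords_star (a b c d : ℤ) :
    star (ofCoords a b c d) = ofCoords (a + c + d) (-b) (-c) (-d) := by
  apply Quaternion.ext <;> simp [re_ofCoords, imI_ofCoords, imJ_ofCoords, imK_ofCoords] <;> ring

theorem normSq_ofCoords (a b c d : ℤ) : normSq (ofCoords a b c d) =
    ((a ^ 2 + b ^ 2 + (a + b) * (c + d) + c ^ 2 + d ^ 2 + c * d : ℤ) : ℝ) := by
  have hs : Real.sqrt 2 ^ 2 = 2 := Real.sq_sqrt (by norm_num)
  rw [Quaternion.normSq_def', re_ofCoords, imI_ofCoords, imJ_ofCoords, imK_ofCoords]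
  push_cast
  ring_nf
  rw [hs]
  ring

theorem intCast_eq_ofCoords (n : ℤ) : (n : ℍ[ℝ]) = ofCoords n 0 0 0 := by
  apply Quaternion.ext <;> simp [re_ofCoords, imI_ofCoords, imJ_ofCoords, imK_ofCoords]

theorem natCast_eq_ofCoords (n : ℕ) : (n : ℍ[ℝ]) = ofCoords n 0 0 0 :=
  mod_cast intCast_eq_ofCoords n

theorem one_eq_ofCoords : (1 : ℍ[ℝ]) = ofCoords 1 0 0 0 := mod_cast natCast_eq_ofCoords 1

/-- `H₍₁,₂,₂₎` as a subring of the quaternions. -/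
def order122 : Subring ℍ[ℝ] where
  carrier := H122
  mul_mem' := by
    rintro _ _ ⟨a, b, c, d, rfl⟩ ⟨e, f, g, h, rfl⟩
    exact (ofCoords_mul a b c d e f g h).symm ▸ ofCoords_mem _ _ _ _
  one_mem' := one_eq_ofCoords ▸ ofCoords_mem _ _ _ _
  add_mem' := by
    rintro _ _ ⟨a, b, c, d, rfl⟩ ⟨e, f, g, h, rfl⟩
    exact (ofCoords_add a b c d e f g h).symm ▸ ofCoords_mem _ _ _ _
  zero_mem' := ⟨0, 0, 0, 0, by simp⟩
  neg_mem' := by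
    rintro _ ⟨a, b, c, d, rfl⟩
    exact (ofCoords_neg a b c d).symm ▸ ofCoords_mem _ _ _ _

theorem mem_order122 {q : ℍ[ℝ]} : q ∈ order122 ↔ ∃ a b c d : ℤ, q = ofCoords a b c d := Iff.rfl

theorem ofCoords_mem_order122 (a b c d : ℤ) : ofCoords a b c d ∈ order122 :=
  ofCoords_mem a b c d

theorem star_mem_order122 {q : ℍ[ℝ]} (hq : q ∈ order122) : star q ∈ order122 := by
  obtain ⟨a, b, c, d, rfl⟩ := mem_order122.1 hq
  exact ofCoords_star a b c d ▸ ofCoords_mem_order122 _ _ _ _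

theorem exists_normSq_eq_natCast {q : ℍ[ℝ]} (hq : q ∈ order122) : ∃ n : ℕ, normSq q = n := by
  obtain ⟨a, b, c, d, rfl⟩ := mem_order122.1 hq
  have h := normSq_ofCoords a b c d
  set m := a ^ 2 + b ^ 2 + (a + b) * (c + d) + c ^ 2 + d ^ 2 + c * d
  have hm : 0 ≤ m := by exact_mod_cast h ▸ Quaternion.normSq_nonneg (a := ofCoords a b c d)
  obtain ⟨n, hn⟩ := Int.eq_ofNat_of_zero_le hm
  exact ⟨n, by rw [h, hn, Int.cast_natCast]⟩

/-- Every quaternion is at distance less than one from `H₍₁,₂,₂₎`. -/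
theorem exists_normSq_sub_lt_one (q : ℍ[ℝ]) : ∃ h ∈ order122, normSq (q - h) < 1 := by
  have hs : Real.sqrt 2 ^ 2 = 2 := Real.sq_sqrt (by norm_num)
  set x := q.re
  set y := q.imI
  set z := q.imJ
  set w := q.imK
  have round_sq (t : ℝ) : (t - round t) ^ 2 ≤ 1 / 4 := by
    have := abs_le.1 (abs_sub_round t)
    nlinarith
  set c := round (Real.sqrt 2 * z) with hc
  set d := round (Real.sqrt 2 * w) with hd
  set a := round (x - (c + d) / 2) with ha
  set b := round (y - (c + d) / 2) with hb
  refine ⟨ofCoords a b c d, ofCoords_mem_order122 _ _ _ _, ?_⟩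
  have h1 := round_sq (x - (c + d) / 2)
  have h2 := round_sq (y - (c + d) / 2)
  have h3 := round_sq (Real.sqrt 2 * z)
  have h4 := round_sq (Real.sqrt 2 * w)
  rw [← ha] at h1
  rw [← hb] at h2
  rw [← hc] at h3
  rw [← hd] at h4
  have key (t e : ℝ) : (t - Real.sqrt 2 / 2 * e) ^ 2 = (Real.sqrt 2 * t - e) ^ 2 / 2 := by
    linear_combination (e ^ 2 / 4 - t ^ 2 / 2) * hs
  rw [Quaternion.normSq_def']
  simp only [re_ofCoords, imI_ofCoords, imJ_ofCoords, imK_ofCoords,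
    Quaternion.re_sub, Quaternion.imI_sub, Quaternion.imJ_sub, Quaternion.imK_sub, key]
  nlinarith

theorem primary_ofCoords_iff (a b c d : ℤ) : Primary (ofCoords a b c d) ↔
    a % 2 = 1 ∧ b % 2 = 0 ∧ c % 2 = 0 ∧ d % 2 = 0 ∧ (a + b - 1 - d) % 4 = 0 := by
  have hv₂ : v₂ = ofCoords 0 1 0 0 := by simp [ofCoords]
  have hv₃ : v₃ = ofCoords 0 0 1 0 := by simp [ofCoords]
  have h2 : (2 : ℍ[ℝ]) = ofCoords 2 0 0 0 := mod_cast natCast_eq_ofCoords 2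
  have hmul (e f g h : ℤ) : 2 * (1 + v₂) * ofCoords e f g h =
      ofCoords (2 * e - 2 * f - 2 * g) (2 * f + 2 * e + 2 * h) (2 * g - 2 * h)
        (2 * h + 2 * g) := by
    rw [hv₂, h2, one_eq_ofCoords, ofCoords_add, ofCoords_mul, ofCoords_mul]
    congr 1 <;> ring
  have h3 : 1 + 2 * v₃ = ofCoords 1 0 2 0 := by
    rw [hv₃, h2, one_eq_ofCoords, ofCoords_mul, ofCoords_add]
    congr 1
  have hone (h : ℍ[ℝ]) : ofCoords a b c d - 1 = 2 * (1 + v₂) * h ↔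
      ofCoords a b c d = 2 * (1 + v₂) * h + ofCoords 1 0 0 0 := by
    rw [sub_eq_iff_eq_add, ← one_eq_ofCoords]
  simp only [Primary, h3, hone, sub_eq_iff_eq_add]
  constructor
  · rintro ⟨-, ⟨_, ⟨e, f, g, h, rfl⟩, H⟩ | ⟨_, ⟨e, f, g, h, rfl⟩, H⟩⟩ <;>
    · rw [← ofCoords, hmul, ofCoords_add] at H
      obtain ⟨h1, h2, h3, h4⟩ := ofCoords_inj H
      omega
  · rintro ⟨h1, h2, h3, h4, h5⟩
    refine ⟨ofCoords_mem _ _ _ _, ?_⟩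
    rcases (by omega : (c - d) % 4 = 0 ∨ (c - d) % 4 = 2) with hcd | hcd
    · refine .inl ⟨ofCoords ((a - 1 + b + c) / 4) (b / 2 - (d - c) / 4 - (a - 1 + b + c) / 4)
        ((c + d) / 4) ((d - c) / 4), ofCoords_mem _ _ _ _, ?_⟩
      rw [hmul, ofCoords_add]
      congr 1 <;> omega
    · refine .inr ⟨ofCoords ((a - 1 + b + (c - 2)) / 4)
        (b / 2 - (d - (c - 2)) / 4 - (a - 1 + b + (c - 2)) / 4)
        ((c - 2 + d) / 4) ((d - (c - 2)) / 4), ofCoords_mem _ _ _ _, ?_⟩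
      rw [hmul, ofCoords_add]
      congr 1 <;> omega


/-- Multiplication by `1 + 2s` on either side, in coordinates. -/
theorem exists_ofCoords_mul_eq (a b c d e f g h : ℤ) : ∃ A B C D : ℤ,
    ofCoords a b c d * ofCoords e f g h = ofCoords A B C D ∧
    ofCoords (1 + 2 * a) (2 * b) (2 * c) (2 * d) * ofCoords e f g h =
      ofCoords (e + 2 * A) (f + 2 * B) (g + 2 * C) (h + 2 * D) ∧
    ofCoords a b c d * ofCoords (1 + 2 * e) (2 * f) (2 * g) (2 * h) =
      ofCoords (a + 2 * A) (b + 2 * B) (c + 2 * C) (d + 2 * D) := by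
  refine ⟨_, _, _, _, ofCoords_mul .., ?_, ?_⟩ <;> rw [ofCoords_mul] <;> congr 1 <;> ring

theorem Primary.of_mul_left {π x : ℍ[ℝ]} (hπ : Primary π) (hx : x ∈ order122)
    (h : Primary (π * x)) : Primary x := by
  obtain ⟨a, b, c, d, rfl⟩ := mem_order122.1 hπ.1
  obtain ⟨e, f, g, k, rfl⟩ := mem_order122.1 hx
  obtain ⟨h1, h2, h3, h4, h5⟩ := (primary_ofCoords_iff ..).1 hπ
  obtain ⟨a, rfl⟩ : ∃ a', a = 1 + 2 * a' := ⟨a / 2, by omega⟩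
  obtain ⟨b, rfl⟩ : ∃ b', b = 2 * b' := ⟨b / 2, by omega⟩
  obtain ⟨c, rfl⟩ : ∃ c', c = 2 * c' := ⟨c / 2, by omega⟩
  obtain ⟨d, rfl⟩ : ∃ d', d = 2 * d' := ⟨d / 2, by omega⟩
  obtain ⟨A, B, C, D, hABCD, hmul, -⟩ := exists_ofCoords_mul_eq a b c d e f g k
  rw [hmul, primary_ofCoords_iff] at h
  obtain ⟨e, rfl⟩ : ∃ a', e = 1 + 2 * a' := ⟨e / 2, by omega⟩
  obtain ⟨f, rfl⟩ : ∃ b', f = 2 * b' := ⟨f / 2, by omega⟩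
  obtain ⟨g, rfl⟩ : ∃ c', g = 2 * c' := ⟨g / 2, by omega⟩
  obtain ⟨k, rfl⟩ : ∃ d', k = 2 * d' := ⟨k / 2, by omega⟩
  obtain ⟨A', B', C', D', -, -, hmul'⟩ := exists_ofCoords_mul_eq a b c d e f g k
  obtain ⟨i1, i2, i3, i4⟩ := ofCoords_inj (hmul'.symm.trans hABCD)
  rw [primary_ofCoords_iff]
  omega

theorem Primary.eq_one {u : ℍ[ℝ]} (hu : Primary u) (h : normSq u = 1) : u = 1 := by
  obtain ⟨a, b, c, d, rfl⟩ := mem_order122.1 hu.1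
  rw [primary_ofCoords_iff] at hu
  rw [normSq_ofCoords] at h
  have h : a ^ 2 + b ^ 2 + (a + b) * (c + d) + c ^ 2 + d ^ 2 + c * d = 1 := by exact_mod_cast h
  have hc : c = 0 := by
    have : c ^ 2 ≤ 2 := by
      nlinarith [sq_nonneg (2 * a + c + d), sq_nonneg (2 * b + c + d), sq_nonneg d]
    have h1 : c < 2 := by nlinarith
    have h2 : -2 < c := by nlinarith
    omega
  have hd : d = 0 := by
    have : d ^ 2 ≤ 2 := by
      nlinarith [sq_nonneg (2 * a + c + d), sq_nonneg (2 * b + c + d), sq_nonneg c]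
    have h1 : d < 2 := by nlinarith
    have h2 : -2 < d := by nlinarith
    omega
  subst hc hd
  have hb : b = 0 := by
    have h1 : b < 2 := by nlinarith
    have h2 : -2 < b := by nlinarith
    omega
  subst hb
  have ha : a = 1 := by
    have h1 : a < 2 := by nlinarith
    have h2 : -2 < a := by nlinarith
    omega
  rw [ha, one_eq_ofCoords]

theorem Primary.eq_one_of_mul {π u : ℍ[ℝ]} (hπ : Primary π) (hu : u ∈ order122)
    (h : normSq u = 1) (hπu : Primary (π * u)) : u = 1 :=
  (hπ.of_mul_left hu hπu).eq_one h

theorem Primary.odd_normSq {q : ℍ[ℝ]} (hq : Primary q) {n : ℕ} (hn : normSq q = n) : Odd n := by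
  obtain ⟨a, b, c, d, rfl⟩ := mem_order122.1 hq.1
  rw [primary_ofCoords_iff] at hq
  rw [normSq_ofCoords] at hn
  have h : a ^ 2 + b ^ 2 + (a + b) * (c + d) + c ^ 2 + d ^ 2 + c * d = n := by exact_mod_cast hn
  have ha : Odd a := Int.odd_iff.2 hq.1
  have hb : Even b := Int.even_iff.2 hq.2.1
  have hc : Even c := Int.even_iff.2 hq.2.2.1
  have hd : Even d := Int.even_iff.2 hq.2.2.2.1
  have : Odd (n : ℤ) := by
    rw [← h]
    rw [← Int.not_even_iff_odd] at ha ⊢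
    simp [parity_simps, hb, hc, hd, ha]
  exact_mod_cast this

set_option maxRecDepth 100000 in
/-- Every class of odd norm modulo `2` contains a unit. -/
theorem exists_unit_fin : ∀ a b c d : Fin 2,
    (a.1 ^ 2 + b.1 ^ 2 + (a.1 + b.1) * (c.1 + d.1) + c.1 ^ 2 + d.1 ^ 2 + c.1 * d.1) % 2 = 1 →
    ∃ e f g h : Fin 3,
      (e.1 - 1 : ℤ) ^ 2 + (f.1 - 1) ^ 2 + (e.1 - 1 + (f.1 - 1)) * (g.1 - 1 + (h.1 - 1)) +
        (g.1 - 1) ^ 2 + (h.1 - 1) ^ 2 + (g.1 - 1) * (h.1 - 1) = 1 ∧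
      (a.1 + 1) % 2 = e.1 % 2 ∧ (b.1 + 1) % 2 = f.1 % 2 ∧ (c.1 + 1) % 2 = g.1 % 2 ∧
      (d.1 + 1) % 2 = h.1 % 2 := by
  decide

theorem exists_unit_modTwo (a b c d : ℤ)
    (h : Odd (a ^ 2 + b ^ 2 + (a + b) * (c + d) + c ^ 2 + d ^ 2 + c * d)) :
    ∃ e f g k : ℤ, normSq (ofCoords (a + 2 * e) (b + 2 * f) (c + 2 * g) (d + 2 * k)) = 1 := by
  have emod_two (t : ℤ) : ∃ (r : Fin 2) (s : ℤ), t = r.1 + 2 * s :=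
    ⟨⟨(t % 2).toNat, by omega⟩, t / 2, by dsimp; omega⟩
  obtain ⟨a, a', rfl⟩ := emod_two a
  obtain ⟨b, b', rfl⟩ := emod_two b
  obtain ⟨c, c', rfl⟩ := emod_two c
  obtain ⟨d, d', rfl⟩ := emod_two d
  obtain ⟨e, f, g, k, H, h1, h2, h3, h4⟩ := exists_unit_fin a b c d (by
    rw [← Nat.odd_iff, ← Int.odd_coe_nat]
    push_cast
    simpa [parity_simps] using h)
  refine ⟨(e.1 - 1 - (a.1 + 2 * a')) / 2, (f.1 - 1 - (b.1 + 2 * b')) / 2,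
    (g.1 - 1 - (c.1 + 2 * c')) / 2, (k.1 - 1 - (d.1 + 2 * d')) / 2, ?_⟩
  have cancel (x y : ℤ) (hxy : (y - x) % 2 = 0) : x + 2 * ((y - x) / 2) = y := by omega
  rw [cancel, cancel, cancel, cancel, normSq_ofCoords]
  · exact_mod_cast H
  all_goals omega

/-- Every element of odd norm has a primary right associate. -/
theorem exists_primary_associate {q : ℍ[ℝ]} (hq : q ∈ order122) {n : ℕ} (hn : normSq q = n)
    (hodd : Odd n) : ∃ u ∈ order122, normSq u = 1 ∧ Primary (q * u) := by
  obtain ⟨a, b, c, d, rfl⟩ := mem_order122.1 hq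
  have hstar := Quaternion.self_mul_star (ofCoords a b c d)
  rw [← Quaternion.normSq_star, ofCoords_star, normSq_ofCoords] at hn
  obtain ⟨e, f, g, k, hu⟩ := exists_unit_modTwo (a + c + d) (-b) (-c) (-d)
    ((by exact_mod_cast hn : _ = (n : ℤ)) ▸ (Int.odd_coe_nat n).2 hodd)
  obtain ⟨A, B, C, D, hABCD, -, -⟩ := exists_ofCoords_mul_eq a b c d e f g k
  have hmul : ofCoords a b c d * ofCoords (a + c + d + 2 * e) (-b + 2 * f) (-c + 2 * g)
      (-d + 2 * k) = ofCoords (n + 2 * A) (2 * B) (2 * C) (2 * D) := by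
    have h2 : ofCoords (a + c + d + 2 * e) (-b + 2 * f) (-c + 2 * g) (-d + 2 * k) =
        star (ofCoords a b c d) + (ofCoords e f g k + ofCoords e f g k) := by
      rw [ofCoords_star, ofCoords_add, ofCoords_add]
      congr 1 <;> ring
    rw [h2, mul_add, mul_add, hABCD, hstar, ← Quaternion.normSq_star, ofCoords_star,
      normSq_ofCoords, hn, Quaternion.coe_natCast, natCast_eq_ofCoords, ofCoords_add, ofCoords_add]
    congr 1 <;> ring
  rw [Nat.odd_iff] at hodd
  rcases (by omega : (n + 2 * A + 2 * B - 1 - 2 * D) % 4 = 0 ∨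
    (n + 2 * A + 2 * B - 1 - 2 * D) % 4 = 2) with h | h
  · refine ⟨_, ofCoords_mem_order122 _ _ _ _, hu, ?_⟩
    rw [hmul, primary_ofCoords_iff]
    omega
  · refine ⟨_, neg_mem (ofCoords_mem_order122 _ _ _ _), by rwa [Quaternion.normSq_neg], ?_⟩
    rw [mul_neg, hmul, ofCoords_neg, primary_ofCoords_iff]
    omega

/-- Right ideals of `H₍₁,₂,₂₎` generated by two elements are principal. -/
theorem exists_right_ideal_generator {x y : ℍ[ℝ]} (hx : x ∈ order122) (hy : y ∈ order122)
    (hy0 : y ≠ 0) : ∃ r ∈ order122, ∃ s ∈ order122, ∃ x' ∈ order122, ∃ y' ∈ order122,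
      x = (x * r + y * s) * x' ∧ y = (x * r + y * s) * y' := by
  classical
  have hex : ∃ n : ℕ, 0 < n ∧ ∃ r ∈ order122, ∃ s ∈ order122, normSq (x * r + y * s) = n := by
    obtain ⟨n, hn⟩ := exists_normSq_eq_natCast hy
    refine ⟨n, Nat.pos_of_ne_zero ?_, 0, zero_mem _, 1, one_mem _, by simpa using hn⟩
    rintro rfl
    exact hy0 (Quaternion.normSq_eq_zero.1 (by simpa using hn))
  obtain ⟨hpos, r, hr, s, hs, hn⟩ := Nat.find_spec hex
  have hmin := fun m => Nat.find_min' hex (m := m)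
  set n := Nat.find hex
  set g := x * r + y * s with hg
  have hpos' : (0 : ℝ) < n := by exact_mod_cast hpos
  have hg0 : g ≠ 0 := by
    rw [← Quaternion.normSq_ne_zero, hn]
    exact hpos'.ne'
  have key : ∀ r' ∈ order122, ∀ s' ∈ order122, ∃ t ∈ order122, x * r' + y * s' = g * t := by
    intro r' hr' s' hs'
    obtain ⟨h, hh, hlt⟩ := exists_normSq_sub_lt_one (g⁻¹ * (x * r' + y * s'))
    refine ⟨h, hh, ?_⟩
    by_contra hne
    have hr'' := sub_mem hr' (mul_mem hr hh)
    have hs'' := sub_mem hs' (mul_mem hs hh)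
    have e₁ : x * (r' - r * h) + y * (s' - s * h) = x * r' + y * s' - g * h := by
      rw [hg]; noncomm_ring
    have e₂ : x * r' + y * s' - g * h = g * (g⁻¹ * (x * r' + y * s') - h) := by
      rw [mul_sub, mul_inv_cancel_left₀ hg0]
    obtain ⟨m, hm⟩ := exists_normSq_eq_natCast (add_mem (mul_mem hx hr'') (mul_mem hy hs''))
    have hm0 : 0 < m := by
      refine Nat.pos_of_ne_zero ?_
      rintro rfl
      rw [Nat.cast_zero, Quaternion.normSq_eq_zero, e₁, sub_eq_zero] at hm
      exact hne hm
    have hle : (n : ℝ) ≤ m := by exact_mod_cast hmin m ⟨hm0, _, hr'', _, hs'', hm⟩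
    rw [← hm, e₁, e₂, map_mul, hn] at hle
    nlinarith
  obtain ⟨x', hx', e₁⟩ := key 1 (one_mem _) 0 (zero_mem _)
  obtain ⟨y', hy', e₂⟩ := key 0 (zero_mem _) 1 (one_mem _)
  exact ⟨r, hr, s, hs, x', hx', y', hy', by simpa using e₁, by simpa using e₂⟩

theorem exists_two_mul_re_eq_intCast {q : ℍ[ℝ]} (hq : q ∈ order122) :
    ∃ t : ℤ, 2 * q.re = t := by
  obtain ⟨a, b, c, d, rfl⟩ := mem_order122.1 hq
  refine ⟨2 * a + c + d, ?_⟩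
  rw [re_ofCoords]
  push_cast
  ring

theorem mul_star_natCast_mul (p : ℕ) (a b : ℍ[ℝ]) :
    a * star ((p : ℍ[ℝ]) * b) = p * (a * star b) := by
  rw [star_mul, star_natCast, ← mul_assoc, (Nat.cast_commute p _).eq]

/-- Elements of the right ideal `c * H + p * H` have norm divisible by `p` when `c` does. -/
theorem dvd_of_normSq_add {c r s : ℍ[ℝ]} (hc : c ∈ order122) (hr : r ∈ order122)
    (hs : s ∈ order122) {p m n : ℕ} (hcm : normSq c = (p * m : ℕ))
    (hn : normSq (c * r + (p : ℍ[ℝ]) * s) = n) : p ∣ n := by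
  obtain ⟨k, hk⟩ := exists_normSq_eq_natCast hr
  obtain ⟨l, hl⟩ := exists_normSq_eq_natCast hs
  obtain ⟨t, ht⟩ := exists_two_mul_re_eq_intCast (mul_mem (mul_mem hc hr) (star_mem_order122 hs))
  have hre : ((p : ℍ[ℝ]) * (c * r * star s)).re = p * (c * r * star s).re := by simp
  rw [Quaternion.normSq_add, map_mul, map_mul, mul_star_natCast_mul, hre, hcm, hk, hl,
    Quaternion.normSq_natCast] at hn
  have : (n : ℤ) = p * (m * k + p * l + t) := by
    have : (n : ℝ) = p * (m * k + p * l + t) := by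
      rw [← hn, ← ht]
      push_cast
      ring
    exact_mod_cast this
  exact Int.natCast_dvd_natCast.1 ⟨_, this⟩

theorem normSq_eq_one_of_mul {p : ℕ} (hp : p ≠ 0) {a b : ℍ[ℝ]} (ha : normSq a = p)
    (hab : normSq (a * b) = p) : normSq b = 1 := by
  rw [map_mul, ha] at hab
  exact mul_left_cancel₀ (Nat.cast_ne_zero.2 hp) (hab.trans (mul_one _).symm)

theorem Primary.eq_of_right_ideal_generator {π ϖ y c r s : ℍ[ℝ]} {p : ℕ} (hp : p ≠ 0)
    (hπ : Primary π) (hϖ : Primary ϖ) (hπp : normSq π = p) (hϖp : normSq ϖ = p) (hy : y ∈ order122)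
    (hr : r ∈ order122) (hs : s ∈ order122) (hπc : π = c * r + p * s) (hϖc : c = ϖ * y) :
    ϖ = π := by
  have hϖu : π = ϖ * (y * r + star ϖ * s) := by
    have : (p : ℍ[ℝ]) = ϖ * star ϖ := by
      rw [Quaternion.self_mul_star, hϖp, Quaternion.coe_natCast]
    rw [hπc, this, hϖc]
    noncomm_ring
  have hu := add_mem (mul_mem hy hr) (mul_mem (star_mem_order122 hϖ.1) hs)
  have h1 := hϖ.eq_one_of_mul hu (normSq_eq_one_of_mul hp hϖp (hϖu ▸ hπp)) (hϖu ▸ hπ)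
  rw [h1, mul_one] at hϖu
  exact hϖu.symm

/-- An element of norm divisible by the odd prime `p` but not itself divisible by `p`
has exactly one primary left factor of norm `p`. -/
theorem exists_unique_primary_left_factor {c : ℍ[ℝ]} (hc : c ∈ order122) {p m : ℕ}
    (hp : p.Prime) (hodd : Odd p) (hcm : normSq c = (p * m : ℕ))
    (hdvd : ¬∃ h ∈ order122, c = p * h) :
    ∃ π x, Primary π ∧ normSq π = p ∧ x ∈ order122 ∧ c = π * x ∧
      ∀ ϖ, Primary ϖ → normSq ϖ = p → (∃ y ∈ order122, c = ϖ * y) → ϖ = π := by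
  have hp0 : (p : ℍ[ℝ]) ≠ 0 := by
    rw [← Quaternion.normSq_ne_zero, Quaternion.normSq_natCast]
    exact pow_ne_zero 2 (Nat.cast_ne_zero.2 hp.ne_zero)
  obtain ⟨r, hr, s, hs, x, hx, y, hy, hcx, hpy⟩ :=
    exists_right_ideal_generator hc (natCast_mem order122 p) hp0
  have hgmem := add_mem (mul_mem hc hr) (mul_mem (natCast_mem order122 p) hs)
  obtain ⟨n, hn⟩ := exists_normSq_eq_natCast hgmem
  obtain ⟨k, hk⟩ := exists_normSq_eq_natCast hy
  have hpn := dvd_of_normSq_add hc hr hs hcm hn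
  have hnk : p ^ 2 = n * k := by
    have := congrArg normSq hpy
    rw [map_mul, hn, hk, Quaternion.normSq_natCast] at this
    exact_mod_cast this
  have hnp : n = p := by
    obtain ⟨i, hi, rfl⟩ := (Nat.dvd_prime_pow hp).1 ⟨k, hnk⟩
    interval_cases i
    · exact absurd (Nat.dvd_one.1 (by simpa using hpn)) hp.one_lt.ne'
    · exact pow_one p
    · have hk1 : k = 1 := by
        have := pow_pos hp.pos 2
        nlinarith
      refine absurd ⟨star y * x, mul_mem (star_mem_order122 hy) hx, ?_⟩ hdvd
      have hyy : y * star y = 1 := by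
        rw [Quaternion.self_mul_star, hk, hk1, Nat.cast_one, Quaternion.coe_one]
      calc c = _ := hcx
        _ = (c * r + p * s) * (y * star y) * x := by rw [hyy, mul_one]
        _ = p * (star y * x) := by
          rw [← mul_assoc, ← hpy, mul_assoc]
  subst hnp
  obtain ⟨u, hu, hu1, hprim⟩ := exists_primary_associate hgmem hn hodd
  have huu : u * star u = 1 := by
    rw [Quaternion.self_mul_star, hu1, Quaternion.coe_one]
  have hnorm : normSq ((c * r + (n : ℍ[ℝ]) * s) * u) = n := by rw [map_mul, hn, hu1, mul_one]
  refine ⟨(c * r + (n : ℍ[ℝ]) * s) * u, star u * x, hprim, hnorm,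
    mul_mem (star_mem_order122 hu) hx, ?_, ?_⟩
  · calc c = _ := hcx
      _ = (c * r + n * s) * (u * star u) * x := by rw [huu, mul_one]
      _ = _ := by noncomm_ring
  · rintro ϖ hϖ hϖn ⟨z, hz, hcz⟩
    refine hprim.eq_of_right_ideal_generator hp.ne_zero hϖ hnorm hϖn hz
      (mul_mem hr hu) (mul_mem hs hu) ?_ hcz
    noncomm_ring

theorem natCast_mul_ofCoords (n : ℕ) (a b c d : ℤ) :
    n * ofCoords a b c d = ofCoords (n * a) (n * b) (n * c) (n * d) := by
  rw [natCast_eq_ofCoords, ofCoords_mul]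
  congr 1 <;> ring

theorem primitive_iff {c : ℍ[ℝ]} :
    Primitive c ↔ Primary c ∧ ∀ n : ℕ, ∀ h ∈ order122, c = n * h → n = 1 := by
  refine and_congr_right fun hc => ⟨fun H n h hh hch => ?_, fun H a b c' d h => ?_⟩
  · obtain ⟨a, b, c, d, rfl⟩ := mem_order122.1 hh
    rw [natCast_mul_ofCoords] at hch
    have := H _ _ _ _ hch
    have h1 := Int.dvd_gcd (Int.dvd_coe_gcd (dvd_mul_right (n : ℤ) a) (dvd_mul_right (n : ℤ) b))
      (Int.dvd_coe_gcd (dvd_mul_right (n : ℤ) c) (dvd_mul_right (n : ℤ) d))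
    rw [this] at h1
    exact Nat.dvd_one.1 h1
  · have h1 := Int.gcd_dvd_left (a := Int.gcd a b) (b := Int.gcd c' d)
    have h2 := Int.gcd_dvd_right (a := Int.gcd a b) (b := Int.gcd c' d)
    generalize Int.gcd (Int.gcd a b) (Int.gcd c' d) = n at h1 h2 ⊢
    obtain ⟨a, rfl⟩ := h1.trans (Int.gcd_dvd_left ..)
    obtain ⟨b, rfl⟩ := h1.trans (Int.gcd_dvd_right ..)
    obtain ⟨c', rfl⟩ := h2.trans (Int.gcd_dvd_left ..)
    obtain ⟨d, rfl⟩ := h2.trans (Int.gcd_dvd_right ..)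
    exact H n _ (ofCoords_mem_order122 a b c' d) (by rw [natCast_mul_ofCoords]; exact h)

theorem Primitive.of_mul_left {π x : ℍ[ℝ]} (hπ : Primary π) (hx : x ∈ order122)
    (h : Primitive (π * x)) : Primitive x := by
  rw [primitive_iff] at h ⊢
  refine ⟨hπ.of_mul_left hx h.1, fun n y hy hxy => h.2 n (π * y) (mul_mem hπ.1 hy) ?_⟩
  rw [hxy, ← mul_assoc, ← mul_assoc, (Nat.cast_commute n π).eq]

theorem mul_star_eq_natCast_iff {q : ℍ[ℝ]} {n : ℕ} : q * star q = n ↔ normSq q = n := by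
  rw [Quaternion.self_mul_star, ← Quaternion.coe_natCast, Quaternion.coe_inj]

theorem prod_mem_of_forall₂ {L qs : List ℍ[ℝ]}
    (h : List.Forall₂ (fun π q => Primary π ∧ π * star π = q) L qs) :
    L.prod ∈ order122 := by
  induction h with
  | nil => exact order122.one_mem
  | cons h _ ih => rw [List.prod_cons]; exact order122.mul_mem h.1.1 ih

/-- Decomposition Theorem: if `c` is a primitive quaternion of `H₍₁,₂,₂₎` and
`(p₁, …, p_k)` is any list of rational primes (with multiplicity, in any order) whose
product is `N(c)`, then there is a unique list `(π₁, …, π_k)` of primary elements with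
`N(πᵢ) = pᵢ` for each `i` and `c = π₁·π₂·⋯·π_k`. -/
theorem decomposition_theorem (c : ℍ[ℝ]) (hc : Primitive c)
    (ps : List ℕ) (hps : ∀ p ∈ ps, p.Prime)
    (hN : c * star c = ((ps.prod : ℕ) : ℍ[ℝ])) :
    ∃! L : List ℍ[ℝ],
      List.Forall₂ (fun π p => Primary π ∧ π * star π = (p : ℍ[ℝ])) L ps ∧
      c = L.prod := by
  induction ps generalizing c with
  | nil =>
    rw [mul_star_eq_natCast_iff, List.prod_nil, Nat.cast_one] at hN
    refine ⟨[], ⟨.nil, hc.1.eq_one hN⟩, ?_⟩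
    rintro L ⟨hL, -⟩
    exact List.forall₂_nil_right_iff.1 hL
  | cons p ps ih =>
    have hp : p.Prime := hps p List.mem_cons_self
    rw [mul_star_eq_natCast_iff, List.prod_cons] at hN
    have hodd : Odd p := (Nat.odd_mul.1 (hc.1.odd_normSq hN)).1
    obtain ⟨π, x, hπ, hπp, hx, rfl, huniq⟩ := exists_unique_primary_left_factor hc.1.1 hp hodd hN
      fun ⟨h, hh, hch⟩ => hp.one_lt.ne' ((primitive_iff.1 hc).2 p h hh hch)
    have hp0 : (p : ℝ) ≠ 0 := Nat.cast_ne_zero.2 hp.ne_zero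
    have hπ0 : π ≠ 0 := Quaternion.normSq_ne_zero.1 (hπp ▸ hp0)
    have hxN : normSq x = ps.prod := by
      rw [map_mul, hπp, Nat.cast_mul] at hN
      exact mul_left_cancel₀ hp0 hN
    obtain ⟨L, ⟨hL, hxL⟩, hLuniq⟩ := ih x (hc.of_mul_left hπ hx)
      (fun q hq => hps q (List.mem_cons_of_mem p hq)) (mul_star_eq_natCast_iff.2 hxN)
    refine ⟨π :: L, ⟨.cons ⟨hπ, mul_star_eq_natCast_iff.2 hπp⟩ hL, by
      rw [List.prod_cons, ← hxL]⟩, ?_⟩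
    rintro L' ⟨hL', hprod⟩
    obtain ⟨ϖ, L'', ⟨hϖ, hϖp⟩, hL'', rfl⟩ := List.forall₂_cons_right_iff.1 hL'
    rw [List.prod_cons] at hprod
    obtain rfl := huniq ϖ hϖ (mul_star_eq_natCast_iff.1 hϖp) ⟨_, prod_mem_of_forall₂ hL'', hprod⟩
    rw [hLuniq L'' ⟨hL'', mul_left_cancel₀ hπ0 hprod⟩]
end
end
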